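/- Let K be a field and m, n positive integers. Every thin indecomposable representation M of the equioriented commutative grid G_{m,n} is isomorphic to the interval representation V_I for some interval I of Fin m × Fin n (necessarily I = supp(M)). -/

import Mathlib

open Classical

structure PRep (K : Type) [Field K] (P : Type) [PartialOrder P] : Type 1 where
  V : P → Type
  [isAddCommGroup : ∀ x, AddCommGroup (V x)]
  [isModule : ∀ x, Module K (V x)]
  [isFinite : ∀ x, Module.Finite K (V x)]
  map : ∀ {x y : P}, x ≤ y → (V x →ₗ[K] V y)
  map_refl : ∀ x : P, map (le_refl x) = LinearMap.id
  map_trans : ∀ {x y z : P} (hxy : x ≤ y) (hyz : y ≤ z),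
    map (le_trans hxy hyz) = (map hyz).comp (map hxy)

attribute [instance] PRep.isAddCommGroup PRep.isModule PRep.isFinite

variable {K : Type} [Field K] {P : Type} [PartialOrder P]

namespace PRep

/-- Isomorphism of representations. -/
def Iso (M N : PRep K P) : Prop :=
  ∃ e : ∀ x : P, M.V x ≃ₗ[K] N.V x,
    ∀ (x y : P) (h : x ≤ y),
      (N.map h).comp (e x : M.V x →ₗ[K] N.V x)
        = (e y : M.V y →ₗ[K] N.V y).comp (M.map h)

/-- Pointwise direct sum of two representations. -/
def dsum (M N : PRep K P) : PRep K P where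
  V x := M.V x × N.V x
  map h := (M.map h).prodMap (N.map h)
  map_refl x := by
    apply LinearMap.ext; intro v
    simp [M.map_refl, N.map_refl]
  map_trans hxy hyz := by
    apply LinearMap.ext; intro v
    simp [M.map_trans hxy hyz, N.map_trans hxy hyz]

def IsThin (M : PRep K P) : Prop := ∀ x : P, Module.finrank K (M.V x) ≤ 1

def supp (M : PRep K P) : Set P := {x : P | Nontrivial (M.V x)}

def Indecomposable (M : PRep K P) : Prop :=
  (∃ x : P, Nontrivial (M.V x)) ∧
  ∀ N₁ N₂ : PRep K P, M.Iso (N₁.dsum N₂) →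
    (∀ x : P, Subsingleton (N₁.V x)) ∨ (∀ x : P, Subsingleton (N₂.V x))

end PRep

/-- Convexity of a subset of a poset. -/
def IsConvexSet (I : Set P) : Prop :=
  ∀ ⦃a b c : P⦄, a ∈ I → c ∈ I → a ≤ b → b ≤ c → b ∈ I

/-- Connectedness of a subset of a poset. -/
def IsConnectedSet (I : Set P) : Prop :=
  ∀ a ∈ I, ∀ b ∈ I,
    Relation.ReflTransGen (fun u v : P => u ∈ I ∧ v ∈ I ∧ (u ≤ v ∨ v ≤ u)) a b

/-- An interval of a poset: nonempty, convex and connected subset. -/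
def IsIntervalSet (I : Set P) : Prop :=
  I.Nonempty ∧ IsConvexSet I ∧ IsConnectedSet I

/-- The interval representation associated to a convex subset `I`. -/
noncomputable def intervalRep (K : Type) [Field K] {P : Type} [PartialOrder P]
    (I : Set P) (hI : IsConvexSet I) : PRep K P where
  V x := ↥(if x ∈ I then (⊤ : Submodule K K) else ⊥)
  map {x y} h :=
    { toFun := fun v => ⟨if y ∈ I then (v : K) else 0, by
        by_cases hy : y ∈ I <;> simp only [hy, if_true, if_false, Submodule.mem_top, Submodule.zero_mem]⟩
      map_add' := fun v w => by
        apply Subtype.ext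
        by_cases hy : y ∈ I <;> simp [hy]
      map_smul' := fun c v => by
        apply Subtype.ext
        by_cases hy : y ∈ I <;> simp [hy] }
  map_refl x := by
    apply LinearMap.ext; intro v
    apply Subtype.ext
    by_cases hx : x ∈ I
    · simp [hx]
    · have hv0 : (v : K) = 0 := by simpa only [hx, if_false, Submodule.mem_bot] using v.2
      show (if x ∈ I then (v : K) else 0) = (v : K)
      exact (if_neg hx).trans hv0.symm
  map_trans {x y z} hxy hyz := by
    apply LinearMap.ext; intro v
    apply Subtype.ext
    by_cases hz : z ∈ I
    · by_cases hy : y ∈ I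
      · show (if z ∈ I then (v : K) else 0)
          = if z ∈ I then (if y ∈ I then (v : K) else 0) else 0
        exact (if_pos hz).trans ((if_pos hz).trans (if_pos hy)).symm
      · by_cases hx : x ∈ I
        · exact absurd (hI hx hz hxy hyz) hy
        · have hv0 : (v : K) = 0 := by simpa only [hx, if_false, Submodule.mem_bot] using v.2
          simp [hz, hy, hv0]
    · simp [hz]

namespace PRep

def IsPreInterval (M : PRep K P) : Prop :=
  M.IsThin ∧ IsIntervalSet M.supp ∧
    ∀ (x y : P) (h : x ≤ y), x ∈ M.supp → y ∈ M.supp → M.map h ≠ 0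

end PRep

/-- A map from a poset to a product of two chains which lifts interpolating points uniquely and is
injective on elements sharing a lower or an upper bound. -/
structure IsGridCover {E α β : Type*} [PartialOrder E] [LinearOrder α] [LinearOrder β]
    (π : E → α × β) : Prop where
  monotone : Monotone π
  exists_between : ∀ {e g : E} {y : α × β}, e ≤ g → π e ≤ y → y ≤ π g →
    ∃ f, π f = y ∧ e ≤ f ∧ f ≤ g
  eq_of_ge : ∀ {e f f' : E}, e ≤ f → e ≤ f' → π f = π f' → f = f'
  eq_of_le : ∀ {e f f' : E}, f ≤ e → f' ≤ e → π f = π f' → f = f'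

namespace IsGridCover

open Relation

section

variable {E α β : Type*} [PartialOrder E]

/-- Comparable elements lying over the same column. -/
def SameBlock (π : E → α × β) (e f : E) : Prop :=
  (π e).1 = (π f).1 ∧ (e ≤ f ∨ f ≤ e)

/-- A comparability step that does not decrease the column. -/
def RightStep (π : E → α × β) (e f : E) : Prop :=
  e ≤ f ∨ (f ≤ e ∧ (π e).1 = (π f).1)

theorem SameBlock.symm {π : E → α × β} {e f : E} (h : SameBlock π e f) : SameBlock π f e :=
  ⟨h.1.symm, h.2.symm⟩

theorem SameBlock.rightStep {π : E → α × β} {e f : E}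
    (h : SameBlock π e f) : RightStep π e f :=
  h.2.imp id fun h' => ⟨h', h.1⟩

theorem RightStep.of_le {π : E → α × β} {e f : E} (h : e ≤ f) : RightStep π e f :=
  Or.inl h

end

variable {E α β : Type*} [PartialOrder E] [LinearOrder α] [LinearOrder β]

theorem dual {π : E → α × β} (hπ : IsGridCover π) :
    IsGridCover (E := Eᵒᵈ) (α := αᵒᵈ) (β := βᵒᵈ)
      (fun e => (OrderDual.toDual (π (OrderDual.ofDual e)).1,
        OrderDual.toDual (π (OrderDual.ofDual e)).2)) where
  monotone _ _ h := hπ.monotone h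
  exists_between := by
    intro e g y h hy hy'
    obtain ⟨f, hf, hgf, hfe⟩ := hπ.exists_between (e := OrderDual.ofDual g)
      (g := OrderDual.ofDual e) (y := (OrderDual.ofDual y.1, OrderDual.ofDual y.2)) h hy' hy
    refine ⟨OrderDual.toDual f, ?_, hfe, hgf⟩
    simp [hf]
  eq_of_ge h h' heq := hπ.eq_of_le h h' heq
  eq_of_le h h' heq := hπ.eq_of_ge h h' heq

variable {π : E → α × β}

/-- Elements above a common one are ordered as their images. -/
theorem le_of_ge (hπ : IsGridCover π) {e f g : E} (hf : e ≤ f) (hg : e ≤ g)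
    (h : π f ≤ π g) : f ≤ g := by
  obtain ⟨f', hf', hef', hf'g⟩ := hπ.exists_between hg (hπ.monotone hf) h
  rwa [hπ.eq_of_ge hf hef' hf'.symm]

/-- Elements below a common one are ordered as their images. -/
theorem le_of_le (hπ : IsGridCover π) {e f g : E} (hf : f ≤ e) (hg : g ≤ e)
    (h : π f ≤ π g) : f ≤ g := by
  obtain ⟨g', hg', hfg', hg'e⟩ := hπ.exists_between hf h (hπ.monotone hg)
  rwa [hπ.eq_of_le hg hg'e hg'.symm]

theorem sameBlock_trans (hπ : IsGridCover π) {e f g : E} (h : SameBlock π e f)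
    (h' : SameBlock π f g) : SameBlock π e g := by
  refine ⟨h.1.trans h'.1, ?_⟩
  have key : π e ≤ π g ∨ π g ≤ π e :=
    (le_total (π e).2 (π g).2).imp (fun hr => ⟨(h.1.trans h'.1).le, hr⟩)
      (fun hr => ⟨(h.1.trans h'.1).ge, hr⟩)
  rcases h.2 with hef | hfe <;> rcases h'.2 with hfg | hgf
  · exact Or.inl (hef.trans hfg)
  · exact key.imp (hπ.le_of_le hef hgf) (hπ.le_of_le hgf hef)
  · exact key.imp (hπ.le_of_ge hfe hfg) (hπ.le_of_ge hfg hfe)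
  · exact Or.inr (hgf.trans hfe)

/-- Along rightward steps, the order is detected on the grid. -/
theorem le_of_rightSteps (hπ : IsGridCover π) {e f : E}
    (h : ReflTransGen (RightStep π) e f) (hef : π e ≤ π f) : e ≤ f := by
  suffices H : (π e).1 ≤ (π f).1 ∧ ∀ f', SameBlock π f' f → π e ≤ π f' → e ≤ f' from
    H.2 f ⟨rfl, Or.inl le_rfl⟩ hef
  clear hef
  induction h with
  | refl =>
    refine ⟨le_rfl, fun f' hf' hle => ?_⟩
    rcases hf'.2 with h | h
    · exact hπ.le_of_le le_rfl h hle
    · exact h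
  | @tail g f _ hs ih =>
    obtain ⟨hcol, ih⟩ := ih
    rcases hs with hgf | ⟨hfg, hc⟩
    · refine ⟨hcol.trans (hπ.monotone hgf).1, fun f' hf' hle => ?_⟩
      have lift : ∀ t, g ≤ t → (π e).2 ≤ (π t).2 → e ≤ t := by
        intro t ht hrow
        obtain ⟨p, hp, hgp, hpt⟩ := hπ.exists_between (y := ((π g).1, (π t).2)) ht
          ⟨le_rfl, (hπ.monotone ht).2⟩ ⟨(hπ.monotone ht).1, le_rfl⟩
        refine (ih p ⟨by rw [hp], Or.inr hgp⟩ ?_).trans hpt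
        rw [hp]
        exact ⟨hcol, hrow⟩
      rcases hf'.2 with h | h
      · exact hπ.le_of_le (lift f hgf (hle.2.trans (hπ.monotone h).2)) h hle
      · exact lift f' (hgf.trans h) hle.2
    · exact ⟨hcol.trans hc.le, fun f' hf' =>
        ih f' (hπ.sameBlock_trans hf' ⟨hc.symm, Or.inl hfg⟩)⟩

theorem fst_le_of_rightStep (hπ : IsGridCover π) {e f : E} (h : RightStep π e f) :
    (π e).1 ≤ (π f).1 :=
  h.elim (fun h => (hπ.monotone h).1) fun h => h.2.le

theorem fst_le_of_rightSteps (hπ : IsGridCover π) {e f : E}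
    (h : ReflTransGen (RightStep π) e f) : (π e).1 ≤ (π f).1 := by
  induction h with
  | refl => exact le_rfl
  | tail _ hs ih => exact ih.trans (hπ.fst_le_of_rightStep hs)

theorem sameBlock_of_rightSteps (hπ : IsGridCover π) {e f : E}
    (h : ReflTransGen (RightStep π) e f) (hcol : (π f).1 ≤ (π e).1) : SameBlock π e f := by
  induction h with
  | refl => exact ⟨rfl, Or.inl le_rfl⟩
  | @tail g f hg hs ih =>
    have hgf := hπ.fst_le_of_rightStep hs
    have hcol' : (π g).1 = (π f).1 := hgf.antisymm (hcol.trans (hπ.fst_le_of_rightSteps hg))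
    exact hπ.sameBlock_trans (ih (hcol'.le.trans hcol)) ⟨hcol', hs.imp id And.left⟩

/-- Two elements reached from the same one, the second by a single comparability, are joined by
rightward steps. -/
theorem rightSteps_total_of_le (hπ : IsGridCover π) {e f g : E}
    (h : ReflTransGen (RightStep π) f e) (hfg : f ≤ g) :
    ReflTransGen (RightStep π) e g ∨ ReflTransGen (RightStep π) g e := by
  suffices H : ∀ f', SameBlock π f' f → f' ≤ g →
      ReflTransGen (RightStep π) e g ∨ ReflTransGen (RightStep π) g e from
    H f ⟨rfl, Or.inl le_rfl⟩ hfg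
  clear hfg
  induction h using ReflTransGen.head_induction_on with
  | refl =>
    exact fun f' hf' hle => Or.inl ((ReflTransGen.single hf'.symm.rightStep).tail (.of_le hle))
  | @head f f₁ hs hT ih =>
    intro f' hf' hle
    rcases hs with hff₁ | ⟨hf₁f, hc⟩
    · obtain ⟨m, hmf₁, hmg⟩ : ∃ m, m ≤ f₁ ∧ m ≤ g := by
        rcases hf'.2 with h | h
        · exact ⟨f', h.trans hff₁, hle⟩
        · exact ⟨f, hff₁, h.trans hle⟩
      have corner : ∀ {s t}, m ≤ s → m ≤ t → (π s).1 ≤ (π t).1 →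
          ∃ p, SameBlock π p s ∧ p ≤ t := by
        intro s t hs ht hst
        obtain ⟨p, hp, hmp, hps⟩ := hπ.exists_between (y := ((π s).1, (π m).2)) hs
          ⟨(hπ.monotone hs).1, le_rfl⟩ ⟨le_rfl, (hπ.monotone hs).2⟩
        refine ⟨p, ⟨by rw [hp], Or.inl hps⟩, hπ.le_of_ge hmp ht ?_⟩
        rw [hp]
        exact ⟨hst, (hπ.monotone ht).2⟩
      rcases le_total (π f₁).1 (π g).1 with hcol | hcol
      · obtain ⟨p, hp, hpg⟩ := corner hmf₁ hmg hcol
        exact ih p hp hpg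
      · obtain ⟨p, hp, hpf₁⟩ := corner hmg hmf₁ hcol
        exact Or.inr ((hT.head (.of_le hpf₁)).head hp.symm.rightStep)
    · exact ih f' (hπ.sameBlock_trans hf' ⟨hc, Or.inr hf₁f⟩) hle

theorem rightSteps_total_of_ge (hπ : IsGridCover π) {e f g : E}
    (h : ReflTransGen (RightStep π) e f) (hgf : g ≤ f) :
    ReflTransGen (RightStep π) e g ∨ ReflTransGen (RightStep π) g e := by
  have key := hπ.dual.rightSteps_total_of_le (e := OrderDual.toDual e) (f := OrderDual.toDual f)
    (g := OrderDual.toDual g)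
  have flip : ∀ a b : E, ReflTransGen (RightStep (E := Eᵒᵈ) (α := αᵒᵈ) (β := βᵒᵈ)
      (fun e => (OrderDual.toDual (π (OrderDual.ofDual e)).1,
        OrderDual.toDual (π (OrderDual.ofDual e)).2))) (OrderDual.toDual b) (OrderDual.toDual a) ↔
      ReflTransGen (RightStep π) a b := by
    intro a b
    rw [← reflTransGen_swap]
    have hR : Function.swap (RightStep (E := Eᵒᵈ) (α := αᵒᵈ) (β := βᵒᵈ)
      (fun e => (OrderDual.toDual (π (OrderDual.ofDual e)).1,
        OrderDual.toDual (π (OrderDual.ofDual e)).2))) = RightStep π := by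
      funext a b
      exact propext (or_congr Iff.rfl (and_congr Iff.rfl eq_comm))
    rw [hR]
    rfl
  exact (key ((flip e f).2 h) hgf).symm.imp (flip e g).1 (flip g e).1

theorem rightSteps_total (hπ : IsGridCover π) {e f : E}
    (h : ReflTransGen (fun a b : E => a ≤ b ∨ b ≤ a) e f) :
    ReflTransGen (RightStep π) e f ∨ ReflTransGen (RightStep π) f e := by
  induction h with
  | refl => exact Or.inl .refl
  | tail _ hs ih =>
    rcases ih with h | h <;> rcases hs with hs | hs
    · exact Or.inl (h.tail (.of_le hs))
    · exact hπ.rightSteps_total_of_ge h hs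
    · exact hπ.rightSteps_total_of_le h hs
    · exact Or.inr (h.head (.of_le hs))

/-- On a zigzag-connected component, the order is detected on the grid. -/
theorem le_of_connected (hπ : IsGridCover π) {e f : E}
    (h : ReflTransGen (fun a b : E => a ≤ b ∨ b ≤ a) e f) (hef : π e ≤ π f) : e ≤ f := by
  rcases hπ.rightSteps_total h with h | h
  · exact hπ.le_of_rightSteps h hef
  · rcases (hπ.sameBlock_of_rightSteps h hef.1).2 with hfe | hle
    · exact hπ.le_of_ge hfe le_rfl hef
    · exact hle

end IsGridCover

namespace PRep

theorem Iso.symm {M N : PRep K P} (h : M.Iso N) : N.Iso M := by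
  obtain ⟨e, he⟩ := h
  refine ⟨fun x => (e x).symm, fun x y hxy => LinearMap.ext fun v => ?_⟩
  have := LinearMap.congr_fun (he x y hxy) ((e x).symm v)
  simp only [LinearMap.comp_apply, LinearEquiv.coe_coe, LinearEquiv.apply_symm_apply] at this ⊢
  rw [this, LinearEquiv.symm_apply_apply]

/-- The subrepresentation given by a compatible family of submodules. -/
def ofSubmodules (M : PRep K P) (A : ∀ x, Submodule K (M.V x))
    (hA : ∀ {x y : P} (h : x ≤ y), ∀ v ∈ A x, M.map h v ∈ A y) : PRep K P where
  V x := A x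
  map h := (M.map h).restrict (hA h)
  map_refl x := LinearMap.ext fun v => Subtype.ext (LinearMap.congr_fun (M.map_refl x) v)
  map_trans hxy hyz :=
    LinearMap.ext fun v => Subtype.ext (LinearMap.congr_fun (M.map_trans hxy hyz) v)

/-- An indecomposable representation is not the internal direct sum of two proper
subrepresentations. -/
theorem Indecomposable.eq_bot_or_eq_bot {M : PRep K P} (hM : M.Indecomposable)
    (A B : ∀ x, Submodule K (M.V x))
    (hA : ∀ {x y : P} (h : x ≤ y), ∀ v ∈ A x, M.map h v ∈ A y)
    (hB : ∀ {x y : P} (h : x ≤ y), ∀ v ∈ B x, M.map h v ∈ B y)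
    (hAB : ∀ x, IsCompl (A x) (B x)) : (∀ x, A x = ⊥) ∨ (∀ x, B x = ⊥) := by
  have key := hM.2 (M.ofSubmodules A hA) (M.ofSubmodules B hB) <| Iso.symm
    ⟨fun x => Submodule.prodEquivOfIsCompl _ _ (hAB x), fun x y h => LinearMap.ext fun v =>
      map_add (M.map h) v.1.1 v.2.1⟩
  exact key.imp (fun h x => Submodule.subsingleton_iff_eq_bot.1 (h x))
    (fun h x => Submodule.subsingleton_iff_eq_bot.1 (h x))

/-- A nonzero vector of a representation. -/
structure Elem (M : PRep K P) where
  pt : P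
  vec : M.V pt
  ne_zero : vec ≠ 0

namespace Elem

variable {M : PRep K P}

instance : PartialOrder M.Elem where
  le e f := ∃ h : e.pt ≤ f.pt, M.map h e.vec = f.vec
  le_refl e := ⟨le_rfl, LinearMap.congr_fun (M.map_refl e.pt) e.vec⟩
  le_trans e f g := by
    rintro ⟨h, hv⟩ ⟨h', hv'⟩
    exact ⟨h.trans h', by rw [M.map_trans h h', LinearMap.comp_apply, hv, hv']⟩
  le_antisymm e f := by
    obtain ⟨x, v, hv⟩ := e
    obtain ⟨y, w, hw⟩ := f
    rintro ⟨h, hvw⟩ ⟨h', -⟩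
    obtain rfl : x = y := le_antisymm h h'
    obtain rfl : v = w := (LinearMap.congr_fun (M.map_refl x) v).symm.trans hvw
    rfl

end Elem

theorem IsThin.exists_smul_eq {M : PRep K P} (hM : M.IsThin) {x : P} {v : M.V x} (hv : v ≠ 0)
    (w : M.V x) : ∃ c : K, c • v = w := by
  have : Nontrivial (M.V x) := ⟨v, 0, hv⟩
  exact (finrank_eq_one_iff_of_nonzero' v hv).1
    (le_antisymm (hM x) (Module.finrank_pos (R := K) (M := M.V x))) w

/-- The nonzero vectors of a thin representation of a product of two chains cover the grid. -/
theorem IsThin.isGridCover {α β : Type} [LinearOrder α] [LinearOrder β]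
    {M : PRep K (α × β)} (hM : M.IsThin) : IsGridCover (Elem.pt : M.Elem → α × β) where
  monotone _ _ h := h.1
  exists_between := by
    rintro e g y ⟨h, hv⟩ hy hy'
    have hyv : M.map hy' (M.map hy e.vec) = g.vec := by
      rw [← LinearMap.comp_apply, ← M.map_trans, hv]
    refine ⟨⟨y, M.map hy e.vec, fun h0 => g.ne_zero ?_⟩, rfl, ⟨hy, rfl⟩, ⟨hy', hyv⟩⟩
    rw [← hyv, h0, map_zero]
  eq_of_ge := by
    rintro e ⟨x, v, hv⟩ ⟨y, w, hw⟩ ⟨h, hev⟩ ⟨h', hew⟩ heq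
    obtain rfl : x = y := heq
    obtain rfl : v = w := hev.symm.trans hew
    rfl
  eq_of_le := by
    rintro ⟨z, u, hu⟩ ⟨x, v, hv⟩ ⟨y, w, hw⟩ ⟨h, hvu⟩ ⟨h', hwu⟩ heq
    obtain rfl : x = y := heq
    obtain ⟨c, rfl⟩ := hM.exists_smul_eq hv w
    have hc : c • u = u := by
      simp only at hvu hwu
      rw [map_smul, hvu] at hwu
      exact hwu
    have : (c - 1) • u = 0 := by rw [sub_smul, hc, one_smul, sub_self]
    obtain rfl : c = 1 := sub_eq_zero.1 ((smul_eq_zero.1 this).resolve_right hu)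
    simp

/-- The zigzag component of a nonzero vector of a thin indecomposable representation covers the
support. -/
theorem Indecomposable.exists_connected {M : PRep K P} (hM : M.Indecomposable) (hthin : M.IsThin)
    (e₀ : M.Elem) {x : P} (hx : x ∈ M.supp) :
    ∃ e : M.Elem, e.pt = x ∧ Relation.ReflTransGen (fun a b : M.Elem => a ≤ b ∨ b ≤ a) e₀ e := by
  set C : Set P := {x | ∃ e : M.Elem, e.pt = x ∧
    Relation.ReflTransGen (fun a b : M.Elem => a ≤ b ∨ b ≤ a) e₀ e}
  have hmap : ∀ {x y : P} (h : x ≤ y) (v : M.V x), M.map h v ≠ 0 → (x ∈ C ↔ y ∈ C) := by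
    intro x y h v hv
    have hv0 : v ≠ 0 := fun h0 => hv (by rw [h0, map_zero])
    constructor
    · rintro ⟨⟨_, w, hw⟩, rfl, he⟩
      obtain ⟨c, rfl⟩ := hthin.exists_smul_eq hw v
      have hw' : M.map h w ≠ 0 := fun h0 => hv (by rw [map_smul, h0, smul_zero])
      exact ⟨⟨y, M.map h w, hw'⟩, rfl, he.tail (Or.inl ⟨h, rfl⟩)⟩
    · rintro ⟨⟨_, w, hw⟩, rfl, he⟩
      obtain ⟨c, hc⟩ := hthin.exists_smul_eq hv w
      have hc0 : c ≠ 0 := by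
        rintro rfl
        exact hw (by rw [← hc, zero_smul])
      exact ⟨⟨x, c • v, smul_ne_zero hc0 hv0⟩, rfl,
        he.tail (Or.inr ⟨h, by simp only [map_smul, hc]⟩)⟩
  have key := hM.eq_bot_or_eq_bot (fun x => if x ∈ C then ⊤ else ⊥)
    (fun x => if x ∈ C then ⊥ else ⊤)
    (by
      intro x y h v hv
      by_cases h0 : M.map h v = 0
      · rw [h0]; exact Submodule.zero_mem _
      by_cases hy : y ∈ C
      · simp [hy]
      have hxC : x ∉ C := fun hxC => hy ((hmap h v h0).1 hxC)
      exact absurd (by simpa [hxC] using hv) fun hv : v = 0 => h0 (by rw [hv, map_zero]))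
    (by
      intro x y h v hv
      by_cases h0 : M.map h v = 0
      · rw [h0]; exact Submodule.zero_mem _
      by_cases hy : y ∈ C
      · have hxC : x ∈ C := (hmap h v h0).2 hy
        exact absurd (by simpa [hxC] using hv) fun hv : v = 0 => h0 (by rw [hv, map_zero])
      · simp [hy])
    (fun x => by
      by_cases hxC : x ∈ C
      · simpa [hxC] using isCompl_top_bot
      · simpa [hxC] using isCompl_bot_top)
  change x ∈ C
  rcases key with h | h
  · have h₀ : e₀.pt ∈ C := ⟨e₀, rfl, .refl⟩
    have : e₀.vec ∈ (⊥ : Submodule K (M.V e₀.pt)) := by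
      rw [← h e₀.pt, if_pos h₀]
      trivial
    exact absurd ((Submodule.mem_bot K).1 this) e₀.ne_zero
  · by_contra hxC
    have : Nontrivial (M.V x) := hx
    have hx' := h x
    simp only [if_neg hxC] at hx'
    exact top_ne_bot hx'

/-- A thin representation with a compatible choice of nonzero vectors on its support is an interval
representation. -/
theorem IsThin.iso_intervalRep {M : PRep K P} (hM : M.IsThin) (hI : IsConvexSet M.supp)
    (b : ∀ x, M.V x) (hb : ∀ x ∈ M.supp, b x ≠ 0)
    (hmap : ∀ {x y : P} (h : x ≤ y), x ∈ M.supp → y ∈ M.supp → M.map h (b x) = b y) :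
    M.Iso (intervalRep K M.supp hI) := by
  have hzero : ∀ x ∉ M.supp, ∀ c : (intervalRep K M.supp hI).V x, c.1 = 0 := by
    intro x hx c
    have h : (if x ∈ M.supp then (⊤ : Submodule K K) else ⊥) ≤ ⊥ := (if_neg hx).le
    exact (Submodule.mem_bot K).1 (h c.2)
  have hsub : ∀ x ∉ M.supp, Subsingleton (M.V x) := fun x hx => not_nontrivial_iff_subsingleton.1 hx
  let g : ∀ x, (intervalRep K M.supp hI).V x →ₗ[K] M.V x := fun x =>
    (LinearMap.toSpanSingleton K (M.V x) (b x)).comp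
      (if x ∈ M.supp then (⊤ : Submodule K K) else ⊥).subtype
  have hg : ∀ x c, g x c = c.1 • b x := fun x c => rfl
  have hbij : ∀ x, Function.Bijective (g x) := by
    intro x
    by_cases hx : x ∈ M.supp
    · refine ⟨fun c d hcd => Subtype.ext (smul_left_injective K (hb x hx) hcd), fun w => ?_⟩
      obtain ⟨c, hc⟩ := hM.exists_smul_eq (hb x hx) w
      exact ⟨⟨c, by rw [if_pos hx]; trivial⟩, hc⟩
    · have := hsub x hx
      exact ⟨fun c d _ => Subtype.ext ((hzero x hx c).trans (hzero x hx d).symm),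
        fun w => ⟨0, Subsingleton.elim _ _⟩⟩
  refine Iso.symm ⟨fun x => LinearEquiv.ofBijective (g x) (hbij x), fun x y h =>
    LinearMap.ext fun c => ?_⟩
  change M.map h (g x c) = g y ((intervalRep K M.supp hI).map h c)
  by_cases hy : y ∈ M.supp
  · have hc : ((intervalRep K M.supp hI).map h c).1 = c.1 := if_pos hy
    rw [hg, hg, hc, map_smul]
    by_cases hx : x ∈ M.supp
    · rw [hmap h hx hy]
    · rw [hzero x hx c, zero_smul, zero_smul]
  · have := hsub y hy
    exact Subsingleton.elim _ _

end PRep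

/-- Every thin indecomposable representation of the equioriented
commutative grid `G_{m,n}` is isomorphic to the interval representation `V_I`
for some interval `I` (necessarily `I = supp M`). -/
theorem thin_indecomposable_iso_interval (K : Type) [Field K] (m n : ℕ)
    (hm : 0 < m) (hn : 0 < n) (M : PRep K (Fin m × Fin n))
    (hthin : M.IsThin) (hind : M.Indecomposable) :
    ∃ (I : Set (Fin m × Fin n)) (hI : IsIntervalSet I),
      I = M.supp ∧ M.Iso (intervalRep K I hI.2.1) := by
  obtain ⟨x₀, hx₀⟩ := hind.1
  obtain ⟨v₀, hv₀⟩ := exists_ne (0 : M.V x₀)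
  let e₀ : M.Elem := ⟨x₀, v₀, hv₀⟩
  have hπ := hthin.isGridCover
  have : Std.Symm (fun a b : M.Elem => a ≤ b ∨ b ≤ a) := ⟨fun _ _ => Or.symm⟩
  choose s hs hconn using fun (x : _) (hx : x ∈ M.supp) => hind.exists_connected hthin e₀ hx
  have hjoin : ∀ x hx y hy, Relation.ReflTransGen (fun a b : M.Elem => a ≤ b ∨ b ≤ a)
      (s x hx) (s y hy) := fun x hx y hy =>
    (Relation.ReflTransGen.stdSymm.symm _ _ (hconn x hx)).trans (hconn y hy)
  have hle : ∀ x hx y hy, x ≤ y → s x hx ≤ s y hy := fun x hx y hy hxy =>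
    hπ.le_of_connected (hjoin x hx y hy) (by rwa [hs, hs])
  have hsupp : ∀ e : M.Elem, e.pt ∈ M.supp := fun e => ⟨e.vec, 0, e.ne_zero⟩
  have hconv : IsConvexSet M.supp := by
    intro a b c ha hc hab hbc
    obtain ⟨f, rfl, -⟩ := hπ.exists_between (y := b) (hle a ha c hc (hab.trans hbc))
      (by rwa [hs]) (by rwa [hs])
    exact hsupp f
  have hcon : IsConnectedSet M.supp := by
    intro a ha b hb
    have := (hjoin a ha b hb).lift (p := fun u v => u ∈ M.supp ∧ v ∈ M.supp ∧ (u ≤ v ∨ v ≤ u))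
      PRep.Elem.pt fun e f h => ⟨hsupp e, hsupp f, h.imp (fun h => hπ.monotone h)
        fun h => hπ.monotone h⟩
    rwa [Function.onFun, hs, hs] at this
  refine ⟨M.supp, ⟨⟨x₀, hx₀⟩, hconv, hcon⟩, rfl, ?_⟩
  have hvec : ∀ x (hx : x ∈ M.supp), ∃ v : M.V x, ∃ hv : v ≠ 0, s x hx = ⟨x, v, hv⟩ := by
    intro x hx
    rcases hse : s x hx with ⟨y, v, hv⟩
    obtain rfl : y = x := by simpa [hse] using hs x hx
    exact ⟨v, hv, rfl⟩
  choose b hb hsb using hvec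
  refine hthin.iso_intervalRep hconv (fun x => if hx : x ∈ M.supp then b x hx else 0)
    (fun x hx => by simpa only [dif_pos hx] using hb x hx) fun {x y} h hx hy => ?_
  simp only [dif_pos hx, dif_pos hy]
  have := hle x hx y hy h
  rw [hsb, hsb] at this
  exact this.2
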